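/- arXiv:2008.09850 — 2 statements merged into one kernel-verified Lean document; each statement's English description precedes it below -/
import Mathlib

section
/- Let E₁, E₂ be real Banach spaces, φ₁ : E₁ → ℝ and φ₂ : E₂ → ℝ locally Lipschitz functions, and define φ : E₁ × E₂ → ℝ by φ(x₁,x₂) = φ₁(x₁) + φ₂(x₂). If φ₁ is regular at x₁, then for every x₂ ∈ E₂ and every direction (v₁,v₂) ∈ E₁ × E₂ one has the equality φ°((x₁,x₂);(v₁,v₂)) = φ₁°(x₁;v₁) + φ₂°(x₂;v₂). -/
open Filter

/-- The Clarke generalized directional derivative of `ψ` at `x` in direction `v`: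
`ψ°(x;v) = limsup_{w → x, t ↓ 0} (ψ(w + t v) − ψ(w))/t`. -/
noncomputable def clarkeDeriv {E : Type*} [NormedAddCommGroup E] [NormedSpace ℝ E]
    (ψ : E → ℝ) (x v : E) : ℝ :=
  Filter.limsup (fun p : E × ℝ => (ψ (p.1 + p.2 • v) - ψ p.1) / p.2)
    ((nhds x) ×ˢ (nhdsWithin 0 (Set.Ioi (0 : ℝ))))

/-- `ψ` is (Clarke) regular at `x`: for every direction `v`, the one-sided directional
derivative `ψ'(x;v) = lim_{h ↓ 0} (ψ(x + h v) − ψ(x))/h` exists and equals `ψ°(x;v)`. -/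
def clarkeRegularAt {E : Type*} [NormedAddCommGroup E] [NormedSpace ℝ E]
    (ψ : E → ℝ) (x : E) : Prop :=
  ∀ v : E, Filter.Tendsto (fun h : ℝ => (ψ (x + h • v) - ψ x) / h)
    (nhdsWithin 0 (Set.Ioi (0 : ℝ))) (nhds (clarkeDeriv ψ x v))

/-- The difference quotients of a locally Lipschitz function are bounded near the base point. -/
theorem LocallyLipschitz.exists_eventually_abs_quotient_le {E : Type*} [NormedAddCommGroup E]
    [NormedSpace ℝ E] {ψ : E → ℝ} (hψ : LocallyLipschitz ψ) (x v : E) :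
    ∃ C : ℝ, ∀ᶠ p : E × ℝ in nhds x ×ˢ nhdsWithin 0 (Set.Ioi (0 : ℝ)),
      |(ψ (p.1 + p.2 • v) - ψ p.1) / p.2| ≤ C := by
  obtain ⟨K, s, hs, hK⟩ := hψ x
  have hw : Tendsto (fun p : E × ℝ => p.1) (nhds x ×ˢ nhdsWithin 0 (Set.Ioi (0 : ℝ))) (nhds x) :=
    tendsto_fst
  have ht : Tendsto (fun p : E × ℝ => p.2) (nhds x ×ˢ nhdsWithin 0 (Set.Ioi (0 : ℝ)))
      (nhdsWithin 0 (Set.Ioi (0 : ℝ))) := tendsto_snd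
  have hwt : Tendsto (fun p : E × ℝ => p.1 + p.2 • v)
      (nhds x ×ˢ nhdsWithin 0 (Set.Ioi (0 : ℝ))) (nhds x) := by
    simpa using hw.add ((ht.mono_right nhdsWithin_le_nhds).smul_const v)
  refine ⟨K * ‖v‖, ?_⟩
  filter_upwards [hw hs, hwt hs, ht self_mem_nhdsWithin] with p h₁ h₂ h₃
  have hp : 0 < p.2 := h₃
  have h := hK.dist_le_mul _ h₂ _ h₁
  rw [Real.dist_eq, dist_self_add_left, norm_smul, Real.norm_of_nonneg hp.le] at h
  rw [abs_div, abs_of_pos hp, div_le_iff₀ hp]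
  linarith

/-- Upper bounds of the Clarke derivative bound the difference quotients eventually. -/
theorem LocallyLipschitz.eventually_quotient_lt {E : Type*} [NormedAddCommGroup E]
    [NormedSpace ℝ E] {ψ : E → ℝ} (hψ : LocallyLipschitz ψ) {x v : E} {a : ℝ}
    (ha : clarkeDeriv ψ x v < a) :
    ∀ᶠ p : E × ℝ in nhds x ×ˢ nhdsWithin 0 (Set.Ioi (0 : ℝ)),
      (ψ (p.1 + p.2 • v) - ψ p.1) / p.2 < a := by
  obtain ⟨C, hC⟩ := hψ.exists_eventually_abs_quotient_le x v
  exact eventually_lt_of_limsup_lt ha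
    (isBoundedUnder_of_eventually_le (hC.mono fun _ h => (abs_le.1 h).2))

/-- Eventual upper bounds of the difference quotients bound the Clarke derivative. -/
theorem LocallyLipschitz.clarkeDeriv_le {E : Type*} [NormedAddCommGroup E]
    [NormedSpace ℝ E] {ψ : E → ℝ} (hψ : LocallyLipschitz ψ) {x v : E} {a : ℝ}
    (ha : ∀ᶠ p : E × ℝ in nhds x ×ˢ nhdsWithin 0 (Set.Ioi (0 : ℝ)),
      (ψ (p.1 + p.2 • v) - ψ p.1) / p.2 ≤ a) :
    clarkeDeriv ψ x v ≤ a := by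
  obtain ⟨C, hC⟩ := hψ.exists_eventually_abs_quotient_le x v
  exact limsup_le_of_le
    (isBoundedUnder_of_eventually_ge (hC.mono fun _ h => (abs_le.1 h).1)).isCoboundedUnder_le ha

/-- for locally Lipschitz `φ₁ : E₁ → ℝ`, `φ₂ : E₂ → ℝ` on real Banach spaces and
`φ (x₁, x₂) = φ₁ x₁ + φ₂ x₂`, if `φ₁` is regular at `x₁` then
`φ°((x₁,x₂);(v₁,v₂)) = φ₁°(x₁;v₁) + φ₂°(x₂;v₂)` for every `x₂` and every direction. -/
theorem stmt4
    {E₁ E₂ : Type*} [NormedAddCommGroup E₁] [NormedSpace ℝ E₁] [CompleteSpace E₁]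
    [NormedAddCommGroup E₂] [NormedSpace ℝ E₂] [CompleteSpace E₂]
    (φ₁ : E₁ → ℝ) (φ₂ : E₂ → ℝ)
    (hφ₁ : LocallyLipschitz φ₁) (hφ₂ : LocallyLipschitz φ₂)
    (φ : E₁ × E₂ → ℝ) (hφ : ∀ p : E₁ × E₂, φ p = φ₁ p.1 + φ₂ p.2)
    (x₁ : E₁) (hreg : clarkeRegularAt φ₁ x₁) :
    ∀ (x₂ : E₂) (v₁ : E₁) (v₂ : E₂),
      clarkeDeriv φ (x₁, x₂) (v₁, v₂) = clarkeDeriv φ₁ x₁ v₁ + clarkeDeriv φ₂ x₂ v₂ := by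
  intro x₂ v₁ v₂
  have hφL : LocallyLipschitz φ := by
    have h : φ = fun p => φ₁ p.1 + φ₂ p.2 := funext hφ
    rw [h]
    exact (hφ₁.comp LipschitzWith.prod_fst.locallyLipschitz).add
      (hφ₂.comp LipschitzWith.prod_snd.locallyLipschitz)
  have hq : ∀ (w₁ : E₁) (w₂ : E₂) (t : ℝ),
      (φ ((w₁, w₂) + t • (v₁, v₂)) - φ (w₁, w₂)) / t =
        (φ₁ (w₁ + t • v₁) - φ₁ w₁) / t + (φ₂ (w₂ + t • v₂) - φ₂ w₂) / t := by
    intro w₁ w₂ t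
    simp only [hφ, Prod.fst_add, Prod.snd_add, Prod.smul_fst, Prod.smul_snd]
    ring
  apply le_antisymm
  · refine le_of_forall_pos_le_add fun ε hε => hφL.clarkeDeriv_le ?_
    have h₁ := hφ₁.eventually_quotient_lt
      (show clarkeDeriv φ₁ x₁ v₁ < clarkeDeriv φ₁ x₁ v₁ + ε / 2 by linarith)
    have h₂ := hφ₂.eventually_quotient_lt
      (show clarkeDeriv φ₂ x₂ v₂ < clarkeDeriv φ₂ x₂ v₂ + ε / 2 by linarith)
    have hfst : Tendsto (fun p : (E₁ × E₂) × ℝ => (p.1.1, p.2))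
        (nhds (x₁, x₂) ×ˢ nhdsWithin 0 (Set.Ioi (0 : ℝ)))
        (nhds x₁ ×ˢ nhdsWithin 0 (Set.Ioi (0 : ℝ))) :=
      (continuous_fst.tendsto (x₁, x₂)).prodMap tendsto_id
    have hsnd : Tendsto (fun p : (E₁ × E₂) × ℝ => (p.1.2, p.2))
        (nhds (x₁, x₂) ×ˢ nhdsWithin 0 (Set.Ioi (0 : ℝ)))
        (nhds x₂ ×ˢ nhdsWithin 0 (Set.Ioi (0 : ℝ))) :=
      (continuous_snd.tendsto (x₁, x₂)).prodMap tendsto_id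
    filter_upwards [hfst.eventually h₁, hsnd.eventually h₂] with ⟨⟨w₁, w₂⟩, t⟩ h₁ h₂
    rw [hq]
    linarith
  · refine le_of_forall_pos_le_add fun ε hε => ?_
    rw [← le_sub_iff_add_le']
    refine hφ₂.clarkeDeriv_le ?_
    have h := hφL.eventually_quotient_lt (show clarkeDeriv φ (x₁, x₂) (v₁, v₂) <
      clarkeDeriv φ (x₁, x₂) (v₁, v₂) + ε / 2 by linarith)
    have h₁ := (hreg v₁).eventually_const_lt
      (show clarkeDeriv φ₁ x₁ v₁ - ε / 2 < clarkeDeriv φ₁ x₁ v₁ by linarith)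
    have hslice : Tendsto (fun p : E₂ × ℝ => ((x₁, p.1), p.2))
        (nhds x₂ ×ˢ nhdsWithin 0 (Set.Ioi (0 : ℝ)))
        (nhds (x₁, x₂) ×ˢ nhdsWithin 0 (Set.Ioi (0 : ℝ))) :=
      ((Continuous.prodMk_right x₁).tendsto x₂).prodMap tendsto_id
    filter_upwards [hslice.eventually h, tendsto_snd.eventually h₁] with ⟨w₂, t⟩ h h₁
    rw [hq] at h
    linarith
end

section
/- Let γ₁, γ₂ ∈ L^∞_loc(ℝ) and define φ : ℝ² → ℝ by φ(t,s) = ∫₀ᵗ γ₁(ξ)dξ + ∫₀ˢ γ₂(ξ)dξ. Then φ is locally Lipschitz and for every (t,s) ∈ ℝ² the Clarke subdifferential satisfies ∂φ(t,s) ⊆ γ̂₁(t) × γ̂₂(s), where γ̂ₖ(r) = [γ̲ₖ(r), γ̄ₖ(r)] for k = 1, 2. -/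
open MeasureTheory Filter

/-- `γ̄_μ(t) = ess sup_{|s−t|<μ} γ(s)`. -/
noncomputable def essSupNear (γ : ℝ → ℝ) (t μ : ℝ) : ℝ :=
  essSup γ (volume.restrict (Set.Ioo (t - μ) (t + μ)))

/-- `γ̲_μ(t) = ess inf_{|s−t|<μ} γ(s)`. -/
noncomputable def essInfNear (γ : ℝ → ℝ) (t μ : ℝ) : ℝ :=
  essInf γ (volume.restrict (Set.Ioo (t - μ) (t + μ)))

/-- `γ̄(t) = lim_{μ ↓ 0} γ̄_μ(t)`; by monotonicity of `μ ↦ γ̄_μ(t)` this limit equals the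
infimum over `μ > 0`. -/
noncomputable def gammaUpper (γ : ℝ → ℝ) (t : ℝ) : ℝ :=
  ⨅ μ : Set.Ioi (0 : ℝ), essSupNear γ t μ

/-- `γ̲(t) = lim_{μ ↓ 0} γ̲_μ(t)`; by antitonicity of `μ ↦ γ̲_μ(t)` this limit equals the
supremum over `μ > 0`. -/
noncomputable def gammaLower (γ : ℝ → ℝ) (t : ℝ) : ℝ :=
  ⨆ μ : Set.Ioi (0 : ℝ), essInfNear γ t μ

/-- The Clarke subdifferential `∂ψ(x) = {ξ ∈ E* : ⟨ξ,v⟩ ≤ ψ°(x;v) for all v ∈ E}`. -/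
def clarkeSubdiff {E : Type*} [NormedAddCommGroup E] [NormedSpace ℝ E]
    (ψ : E → ℝ) (x : E) : Set (E →L[ℝ] ℝ) :=
  {ξ | ∀ v : E, ξ v ≤ clarkeDeriv ψ x v}

section Helpers

/-- `γ` is locally essentially bounded. -/
def LocEssBounded (γ : ℝ → ℝ) : Prop :=
  ∀ R : ℝ, 0 < R → ∃ C : ℝ, ∀ᵐ s ∂(volume.restrict (Set.Icc (-R) R)), |γ s| ≤ C

theorem LocEssBounded.exists_bound_near {γ : ℝ → ℝ} (h : LocEssBounded γ) (t μ : ℝ) :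
    ∃ C : ℝ, ∀ᵐ s ∂(volume.restrict (Set.Ioo (t - μ) (t + μ))), |γ s| ≤ C := by
  obtain ⟨C, hC⟩ := h (|t| + |μ| + 1) (by positivity)
  refine ⟨C, ae_restrict_of_ae_restrict_of_subset (fun s hs => ?_) hC⟩
  have h₁ := le_abs_self t
  have h₂ := neg_abs_le t
  have h₃ := le_abs_self μ
  constructor <;> linarith [hs.1, hs.2]

theorem LocEssBounded.intervalIntegrable {γ : ℝ → ℝ} (h : LocEssBounded γ) (hm : Measurable γ)
    (a b : ℝ) : IntervalIntegrable γ volume a b := by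
  obtain ⟨C, hC⟩ := h (|a| + |b| + 1) (by positivity)
  have hint : IntegrableOn γ (Set.Icc (-(|a| + |b| + 1)) (|a| + |b| + 1)) :=
    Measure.integrableOn_of_bounded (M := C) (by simp) hm.aestronglyMeasurable hC
  refine (hint.mono_set fun s hs => ?_).intervalIntegrable
  have ha := abs_le.1 (le_refl |a|)
  have hb := abs_le.1 (le_refl |b|)
  have ha₀ := abs_nonneg a
  have hb₀ := abs_nonneg b
  rcases Set.mem_uIcc.1 hs with hs | hs <;> constructor <;> linarith [hs.1, hs.2]

theorem LocEssBounded.ae_le_essSupNear {γ : ℝ → ℝ} (h : LocEssBounded γ) (t μ : ℝ) :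
    ∀ᵐ s ∂(volume.restrict (Set.Ioo (t - μ) (t + μ))), γ s ≤ essSupNear γ t μ := by
  obtain ⟨C, hC⟩ := h.exists_bound_near t μ
  exact _root_.ae_le_essSup ⟨C, eventually_map.2 (hC.mono fun s hs => (abs_le.1 hs).2)⟩

theorem LocEssBounded.ae_essInfNear_le {γ : ℝ → ℝ} (h : LocEssBounded γ) (t μ : ℝ) :
    ∀ᵐ s ∂(volume.restrict (Set.Ioo (t - μ) (t + μ))), essInfNear γ t μ ≤ γ s := by
  obtain ⟨C, hC⟩ := h.exists_bound_near t μ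
  exact _root_.ae_essInf_le ⟨-C, eventually_map.2 (hC.mono fun s hs => (abs_le.1 hs).1)⟩

/-- Integrals of `γ` over intervals near `t` lie between multiples of the length by the essential
infimum and the essential supremum. -/
theorem LocEssBounded.integral_mem_Icc {γ : ℝ → ℝ} (h : LocEssBounded γ) (hm : Measurable γ)
    {t μ a b : ℝ} (ha : t - μ < a) (hab : a ≤ b) (hb : b < t + μ) :
    ∫ ξ in a..b, γ ξ ∈
      Set.Icc (essInfNear γ t μ * (b - a)) (essSupNear γ t μ * (b - a)) := by
  have hsub : Set.Icc a b ⊆ Set.Ioo (t - μ) (t + μ) := Set.Icc_subset_Ioo ha hb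
  have hc (c : ℝ) : ∫ _ in a..b, c = c * (b - a) := by
    rw [intervalIntegral.integral_const, smul_eq_mul, mul_comm]
  rw [← hc, ← hc]
  exact ⟨intervalIntegral.integral_mono_ae_restrict hab (by simp) (h.intervalIntegrable hm a b)
      (ae_restrict_of_ae_restrict_of_subset hsub (h.ae_essInfNear_le t μ)),
    intervalIntegral.integral_mono_ae_restrict hab (h.intervalIntegrable hm a b) (by simp)
      (ae_restrict_of_ae_restrict_of_subset hsub (h.ae_le_essSupNear t μ))⟩

theorem LocEssBounded.locallyLipschitz_primitive {γ : ℝ → ℝ} (h : LocEssBounded γ)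
    (hm : Measurable γ) : LocallyLipschitz fun x => ∫ ξ in (0 : ℝ)..x, γ ξ := by
  intro x
  obtain ⟨C, hC⟩ := h.exists_bound_near x 1
  refine ⟨C.toNNReal, Set.Ioo (x - 1) (x + 1), Ioo_mem_nhds (by linarith) (by linarith),
    LipschitzOnWith.of_dist_le_mul fun a ha b hb => ?_⟩
  rw [Real.dist_eq, Real.dist_eq, intervalIntegral.integral_interval_sub_left
    (h.intervalIntegrable hm _ _) (h.intervalIntegrable hm _ _)]
  rw [← Real.norm_eq_abs]
  refine intervalIntegral.norm_integral_le_of_norm_le_const_ae ?_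
  filter_upwards [(ae_restrict_iff' measurableSet_Ioo).1 hC] with s hs hsab
  have hs' : s ∈ Set.uIcc b a := Set.uIoc_subset_uIcc hsab
  exact (hs (Set.ordConnected_Ioo.uIcc_subset hb ha hs')).trans (Real.le_coe_toNNReal C)

/-- A Clarke derivative is at most any eventual upper bound of the difference quotients, as soon
as these are also eventually bounded below. -/
theorem clarkeDeriv_le_of_eventually {E : Type*} [NormedAddCommGroup E] [NormedSpace ℝ E]
    {ψ : E → ℝ} {x v : E} {m M : ℝ}
    (h : ∀ᶠ p : E × ℝ in nhds x ×ˢ nhdsWithin 0 (Set.Ioi (0 : ℝ)),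
      (ψ (p.1 + p.2 • v) - ψ p.1) / p.2 ∈ Set.Icc m M) :
    clarkeDeriv ψ x v ≤ M :=
  limsup_le_of_le
    (IsBoundedUnder.isCoboundedUnder_le ⟨m, eventually_map.2 (h.mono fun _ hp => hp.1)⟩)
    (h.mono fun _ hp => hp.2)

/-- If the increments of `ψ` in the direction `v` are integrals of `γ`, then Clarke subgradients of
`ψ` applied to `v` lie in the interval spanned by the essential limits of `γ`. -/
theorem LocEssBounded.apply_mem_Icc_of_mem_clarkeSubdiff {E : Type*} [NormedAddCommGroup E]
    [NormedSpace ℝ E] {γ : ℝ → ℝ} (h : LocEssBounded γ) (hm : Measurable γ) {ψ : E → ℝ}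
    {ℓ : E → ℝ} (hℓ : Continuous ℓ) {v : E}
    (hψ : ∀ p r, ψ (p + r • v) - ψ p = ∫ ξ in ℓ p..ℓ p + r, γ ξ) {x : E} {z : E →L[ℝ] ℝ}
    (hz : z ∈ clarkeSubdiff ψ x) :
    z v ∈ Set.Icc (gammaLower γ (ℓ x)) (gammaUpper γ (ℓ x)) := by
  have hev {μ : ℝ} (hμ : 0 < μ) : ∀ᶠ p : E × ℝ in nhds x ×ˢ nhdsWithin 0 (Set.Ioi (0 : ℝ)),
      ℓ p.1 ∈ Set.Ioo (ℓ x - μ / 2) (ℓ x + μ / 2) ∧ p.2 ∈ Set.Ioo 0 (μ / 2) :=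
    (hℓ.continuousAt.eventually (Ioo_mem_nhds (by linarith) (by linarith))).prod_mk
      (Ioo_mem_nhdsGT (half_pos hμ))
  have : Nonempty (Set.Ioi (0 : ℝ)) := ⟨⟨1, Set.mem_Ioi.2 one_pos⟩⟩
  constructor
  · refine ciSup_le fun μ => ?_
    suffices clarkeDeriv ψ x (-v) ≤ -essInfNear γ (ℓ x) μ by
      have hv := (hz (-v)).trans this
      rw [map_neg] at hv
      exact neg_le_neg_iff.1 hv
    refine clarkeDeriv_le_of_eventually (m := -essSupNear γ (ℓ x) μ) ?_
    filter_upwards [hev μ.2] with p ⟨hp, hr⟩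
    have hb := h.integral_mem_Icc hm (t := ℓ x) (μ := μ) (a := ℓ p.1 + -p.2) (b := ℓ p.1)
      (by linarith [hp.1, hr.2]) (by linarith [hr.1]) (by linarith [hp.2, hr.1, hr.2])
    rw [smul_neg, ← neg_smul, hψ, intervalIntegral.integral_symm]
    rw [Set.mem_Icc, le_div_iff₀ hr.1, div_le_iff₀ hr.1]
    constructor <;> linarith [hb.1, hb.2]
  · refine le_ciInf fun μ => (hz v).trans ?_
    refine clarkeDeriv_le_of_eventually (m := essInfNear γ (ℓ x) μ) ?_
    filter_upwards [hev μ.2] with p ⟨hp, hr⟩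
    have hb := h.integral_mem_Icc hm (t := ℓ x) (μ := μ) (a := ℓ p.1) (b := ℓ p.1 + p.2)
      (by linarith [hp.1, hr.1, hr.2]) (by linarith [hr.1]) (by linarith [hp.2, hr.2])
    rw [add_sub_cancel_left] at hb
    rwa [hψ, Set.mem_Icc, le_div_iff₀ hr.1, div_le_iff₀ hr.1]

end Helpers

/-- for `γ₁, γ₂ ∈ L^∞_loc(ℝ)` and `φ(t,s) = ∫₀ᵗ γ₁ + ∫₀ˢ γ₂`, the function `φ`
is locally Lipschitz and `∂φ(t,s) ⊆ [γ̲₁(t), γ̄₁(t)] × [γ̲₂(s), γ̄₂(s)]`, identifying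
`z ∈ (ℝ²)*` with the pair `(z(1,0), z(0,1))`. -/
theorem stmt8 (γ₁ γ₂ : ℝ → ℝ) (hm₁ : Measurable γ₁) (hm₂ : Measurable γ₂)
    (hloc₁ : ∀ R : ℝ, 0 < R →
      ∃ C : ℝ, ∀ᵐ s ∂(volume.restrict (Set.Icc (-R) R)), |γ₁ s| ≤ C)
    (hloc₂ : ∀ R : ℝ, 0 < R →
      ∃ C : ℝ, ∀ᵐ s ∂(volume.restrict (Set.Icc (-R) R)), |γ₂ s| ≤ C)
    (φ : ℝ × ℝ → ℝ)
    (hφ : ∀ p : ℝ × ℝ, φ p = (∫ ξ in (0:ℝ)..p.1, γ₁ ξ) + ∫ ξ in (0:ℝ)..p.2, γ₂ ξ) :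
    LocallyLipschitz φ ∧
      ∀ (t s : ℝ), ∀ z ∈ clarkeSubdiff φ (t, s),
        z (1, 0) ∈ Set.Icc (gammaLower γ₁ t) (gammaUpper γ₁ t) ∧
        z (0, 1) ∈ Set.Icc (gammaLower γ₂ s) (gammaUpper γ₂ s) := by
  have h₁ : LocEssBounded γ₁ := hloc₁
  have h₂ : LocEssBounded γ₂ := hloc₂
  refine ⟨?_, fun t s z hz => ⟨?_, ?_⟩⟩
  · rw [funext hφ]
    exact ((h₁.locallyLipschitz_primitive hm₁).comp LipschitzWith.prod_fst.locallyLipschitz).add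
      ((h₂.locallyLipschitz_primitive hm₂).comp LipschitzWith.prod_snd.locallyLipschitz)
  · refine h₁.apply_mem_Icc_of_mem_clarkeSubdiff hm₁ (ψ := φ) (v := (1, 0))
      (x := (t, s)) continuous_fst (fun p r => ?_) hz
    rw [← intervalIntegral.integral_interval_sub_left (h₁.intervalIntegrable hm₁ 0 _)
      (h₁.intervalIntegrable hm₁ 0 _)]
    simp [hφ]
  · refine h₂.apply_mem_Icc_of_mem_clarkeSubdiff hm₂ (ψ := φ) (v := (0, 1))
      (x := (t, s)) continuous_snd (fun p r => ?_) hz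
    rw [← intervalIntegral.integral_interval_sub_left (h₂.intervalIntegrable hm₂ 0 _)
      (h₂.intervalIntegrable hm₂ 0 _)]
    simp [hφ]
end
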